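/- Assume f : ℝ^d → ℝ is ρ₁-weakly-convex and C₁-Lipschitz continuous, g : ℝ^{d̄} → ℝ^d is C₂-Lipschitz continuous, and either (1) f is monotone and g is L₂-smooth, or (2) f is non-decreasing and g is L₂-weakly-convex. Then the composition f∘g : ℝ^{d̄} → ℝ is ρ̃-weakly-convex with ρ̃ = √d·L₂·C₁ + ρ₁·C₂². -/

import Mathlib

noncomputable section

/-- A real-valued function on a real inner product space is `ρ`-weakly convex if
adding `ρ/2 ‖·‖²` makes it convex. -/
def WeaklyConvex {E : Type*} [NormedAddCommGroup E] [InnerProductSpace ℝ E]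
    (ρ : ℝ) (f : E → ℝ) : Prop :=
  ConvexOn ℝ Set.univ fun x => f x + ρ / 2 * ‖x‖ ^ 2

/-- A vector-valued function is `ρ`-weakly convex if each component is. -/
def WeaklyConvexVec {E : Type*} [NormedAddCommGroup E] [InnerProductSpace ℝ E]
    {m : ℕ} (ρ : ℝ) (g : E → EuclideanSpace ℝ (Fin m)) : Prop :=
  ∀ j : Fin m, WeaklyConvex ρ fun x => g x j

/-- `f` is `C`-Lipschitz continuous. -/
def LipschitzC {E F : Type*} [NormedAddCommGroup E] [NormedAddCommGroup F]
    (C : ℝ) (f : E → F) : Prop :=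
  ∀ x y, ‖f x - f y‖ ≤ C * ‖x - y‖

/-- A scalar function on `ℝ^m` is non-decreasing with respect to each coordinate
of the input. -/
def CoordNonDecreasing {m : ℕ} (f : EuclideanSpace ℝ (Fin m) → ℝ) : Prop :=
  ∀ (k : Fin m) (x : EuclideanSpace ℝ (Fin m)),
    Monotone fun t : ℝ => f (x + t • EuclideanSpace.single k (1 : ℝ))

/-- A scalar function on `ℝ^m` is monotone: with respect to each coordinate of the
input it is either non-decreasing or non-increasing. -/
def CoordMonotone {m : ℕ} (f : EuclideanSpace ℝ (Fin m) → ℝ) : Prop :=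
  ∀ k : Fin m,
    (∀ x, Monotone fun t : ℝ => f (x + t • EuclideanSpace.single k (1 : ℝ))) ∨
    (∀ x, Antitone fun t : ℝ => f (x + t • EuclideanSpace.single k (1 : ℝ)))

/-- A vector-valued function is non-decreasing if each component is non-decreasing
with respect to each coordinate of the input. -/
def CoordNonDecreasingVec {m₁ m₂ : ℕ}
    (g : EuclideanSpace ℝ (Fin m₁) → EuclideanSpace ℝ (Fin m₂)) : Prop :=
  ∀ j : Fin m₂, CoordNonDecreasing fun x => g x j

/-- A vector-valued function is monotone if each component is monotone. -/
def CoordMonotoneVec {m₁ m₂ : ℕ}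
    (g : EuclideanSpace ℝ (Fin m₁) → EuclideanSpace ℝ (Fin m₂)) : Prop :=
  ∀ j : Fin m₂, CoordMonotone fun x => g x j

/-- `f` is `L`-smooth: differentiable with `L`-Lipschitz derivative. -/
def SmoothL {E F : Type*} [NormedAddCommGroup E] [NormedSpace ℝ E]
    [NormedAddCommGroup F] [NormedSpace ℝ F] (L : ℝ) (f : E → F) : Prop :=
  Differentiable ℝ f ∧ ∀ x y, ‖fderiv ℝ f x - fderiv ℝ f y‖ ≤ L * ‖x - y‖

/-- `v` is a general subgradient of `f` at `x`:
`f y ≥ f x + ⟪v, y - x⟫ + o(‖y - x‖)` as `y → x`. -/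
def IsSubgradient {E : Type*} [NormedAddCommGroup E] [InnerProductSpace ℝ E]
    (f : E → ℝ) (x v : E) : Prop :=
  ∀ ε > 0, ∃ δ > 0, ∀ y, ‖y - x‖ < δ →
    f x + @inner ℝ _ _ v (y - x) - ε * ‖y - x‖ ≤ f y

/-- Weak convexity as an inequality along segments. -/
theorem weaklyConvex_iff {E : Type*} [NormedAddCommGroup E] [InnerProductSpace ℝ E]
    {ρ : ℝ} {f : E → ℝ} :
    WeaklyConvex ρ f ↔ ∀ x y : E, ∀ a b : ℝ, 0 ≤ a → 0 ≤ b → a + b = 1 →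
      f (a • x + b • y) ≤ a * f x + b * f y + ρ / 2 * (a * b) * ‖x - y‖ ^ 2 := by
  have key : ∀ x y : E, ∀ a b : ℝ, a + b = 1 →
      ‖a • x + b • y‖ ^ 2 = a * ‖x‖ ^ 2 + b * ‖y‖ ^ 2 - a * b * ‖x - y‖ ^ 2 := by
    intro x y a b hab
    obtain rfl : b = 1 - a := by linarith
    rw [norm_add_sq_real, norm_sub_sq_real, norm_smul, norm_smul, inner_smul_left,
      inner_smul_right, mul_pow, mul_pow, Real.norm_eq_abs, Real.norm_eq_abs, sq_abs, sq_abs]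
    simp only [conj_trivial]
    ring
  constructor
  · intro h x y a b ha hb hab
    have h1 := h.2 (Set.mem_univ x) (Set.mem_univ y) ha hb hab
    simp only [smul_eq_mul, key x y a b hab] at h1
    linarith
  · intro h
    refine ⟨convex_univ, fun x _ y _ a b ha hb hab => ?_⟩
    have h1 := h x y a b ha hb hab
    simp only [smul_eq_mul, key x y a b hab]
    linarith

/-- First-order Taylor bound for a vector-valued map with Lipschitz derivative. -/
theorem SmoothL.norm_sub_sub_fderiv_le {E F : Type*} [NormedAddCommGroup E] [NormedSpace ℝ E]
    [NormedAddCommGroup F] [NormedSpace ℝ F] {L : ℝ} {g : E → F} (hg : SmoothL L g) (z v : E) :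
    ‖g (z + v) - g z - fderiv ℝ g z v‖ ≤ L / 2 * ‖v‖ ^ 2 := by
  have hd : ∀ s : ℝ, HasDerivAt (fun s : ℝ => g (z + s • v) - g z - s • fderiv ℝ g z v)
      (fderiv ℝ g (z + s • v) v - fderiv ℝ g z v) s := by
    intro s
    have h1 : HasDerivAt (fun s : ℝ => z + s • v) v s := by
      simpa using ((hasDerivAt_id s).smul_const v).const_add z
    have h2 : HasDerivAt (fun s : ℝ => s • fderiv ℝ g z v) (fderiv ℝ g z v) s := by
      simpa using (hasDerivAt_id s).smul_const (fderiv ℝ g z v)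
    exact (((hg.1 (z + s • v)).hasFDerivAt.comp_hasDerivAt s h1).sub_const (g z)).sub h2
  have hB : ∀ s : ℝ, HasDerivAt (fun s : ℝ => L / 2 * ‖v‖ ^ 2 * s ^ 2) (L * s * ‖v‖ ^ 2) s := by
    intro s
    refine ((hasDerivAt_pow 2 s).const_mul (L / 2 * ‖v‖ ^ 2)).congr_deriv ?_
    norm_num
    ring
  have h := image_norm_le_of_norm_deriv_right_le_deriv_boundary
    (a := 0) (b := 1) (fun s _ => (hd s).continuousAt.continuousWithinAt)
    (fun s _ => (hd s).hasDerivWithinAt) (by simp) hB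
    (fun s hs => by
      rw [← sub_apply]
      refine (ContinuousLinearMap.le_opNorm _ _).trans ?_
      have h3 := hg.2 (z + s • v) z
      rw [add_sub_cancel_left, norm_smul, Real.norm_of_nonneg hs.1] at h3
      calc _ ≤ L * (s * ‖v‖) * ‖v‖ := mul_le_mul_of_nonneg_right h3 (norm_nonneg v)
        _ = _ := by ring)
    (Set.right_mem_Icc.2 zero_le_one)
  simpa using h

/-- The deviation of a smooth map from affineness along a segment is quadratic. -/
theorem SmoothL.norm_sub_combo_le {E F : Type*} [NormedAddCommGroup E] [NormedSpace ℝ E]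
    [NormedAddCommGroup F] [NormedSpace ℝ F] {L : ℝ} {g : E → F} (hg : SmoothL L g) (x y : E)
    {a b : ℝ} (ha : 0 ≤ a) (hb : 0 ≤ b) (hab : a + b = 1) :
    ‖g (a • x + b • y) - (a • g x + b • g y)‖ ≤ L / 2 * (a * b) * ‖x - y‖ ^ 2 := by
  obtain rfl : a = 1 - b := by linarith
  set z := (1 - b) • x + b • y with hz
  have hx : z + b • (x - y) = x := by rw [hz]; module
  have hy : z + (-(1 - b)) • (x - y) = y := by rw [hz]; module
  have h1 := hg.norm_sub_sub_fderiv_le z (b • (x - y))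
  have h2 := hg.norm_sub_sub_fderiv_le z ((-(1 - b)) • (x - y))
  rw [hx, map_smul, norm_smul, Real.norm_of_nonneg hb] at h1
  rw [hy, map_smul, norm_smul, norm_neg, Real.norm_of_nonneg ha] at h2
  have e : g z - ((1 - b) • g x + b • g y) =
      -((1 - b) • (g x - g z - b • fderiv ℝ g z (x - y)) +
        b • (g y - g z - (-(1 - b)) • fderiv ℝ g z (x - y))) := by module
  rw [e, norm_neg]
  refine (norm_add_le _ _).trans ?_
  rw [norm_smul, norm_smul, Real.norm_of_nonneg hb, Real.norm_of_nonneg ha]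
  have h3 := mul_le_mul_of_nonneg_left h1 ha
  have h4 := mul_le_mul_of_nonneg_left h2 hb
  refine (add_le_add h3 h4).trans (le_of_eq ?_)
  ring

/-- A coordinatewise non-decreasing function is monotone for the product order. -/
theorem CoordNonDecreasing.le_of_forall_le {m : ℕ} {f : EuclideanSpace ℝ (Fin m) → ℝ}
    (hf : CoordNonDecreasing f) {x y : EuclideanSpace ℝ (Fin m)} (hxy : ∀ j, x j ≤ y j) :
    f x ≤ f y := by
  have key : ∀ s : Finset (Fin m),
      f x ≤ f (x + ∑ k ∈ s, (y k - x k) • EuclideanSpace.single k (1 : ℝ)) := by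
    intro s
    induction s using Finset.induction_on with
    | empty => simp
    | insert k s hk ih =>
      refine ih.trans ?_
      have h := hf k (x + ∑ k ∈ s, (y k - x k) • EuclideanSpace.single k (1 : ℝ))
        (sub_nonneg.2 (hxy k))
      rw [Finset.sum_insert hk, add_comm (_ • _), ← add_assoc]
      simpa using h
  convert key Finset.univ using 2
  ext j
  simp [Finset.sum_apply, Pi.single_apply]

/-- A coordinatewise upper bound on the argument, with uniform error, bounds a Lipschitz
non-decreasing function. -/
theorem CoordNonDecreasing.le_add_of_forall_le_add {m : ℕ} {f : EuclideanSpace ℝ (Fin m) → ℝ}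
    (hf : CoordNonDecreasing f) {C : ℝ} (hlip : LipschitzC C f)
    {x y : EuclideanSpace ℝ (Fin m)} {e : ℝ} (he : 0 ≤ e) (hxy : ∀ j, x j ≤ y j + e) :
    f x ≤ f y + C * (Real.sqrt m * e) := by
  set u : EuclideanSpace ℝ (Fin m) := WithLp.toLp 2 fun _ => e with hu
  have hnorm : ‖u‖ = Real.sqrt m * e := by
    rw [EuclideanSpace.norm_eq]
    simp [hu, Real.sqrt_sq he]
  have h1 : f x ≤ f (y + u) := hf.le_of_forall_le fun j => by simpa [hu] using hxy j
  have h2 := (le_abs_self _).trans (hlip (y + u) y)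
  rw [add_sub_cancel_left, hnorm] at h2
  linarith

/-- Proposition 4. If `f : ℝ^d → ℝ` is `ρ₁`-weakly convex and
`C₁`-Lipschitz, `g : ℝ^{d̄} → ℝ^d` is `C₂`-Lipschitz, and either (1) `f` is monotone
and `g` is `L₂`-smooth, or (2) `f` is non-decreasing and `g` is `L₂`-weakly convex,
then `f ∘ g` is `ρ̃`-weakly convex with `ρ̃ = √d L₂ C₁ + ρ₁ C₂²`. -/
theorem composition_weakly_convex
    (d dbar : ℕ) (ρ₁ C₁ C₂ L₂ : ℝ)
    (hρ₁ : 0 ≤ ρ₁) (hC₁ : 0 ≤ C₁) (hC₂ : 0 ≤ C₂) (hL₂ : 0 ≤ L₂)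
    (f : EuclideanSpace ℝ (Fin d) → ℝ)
    (g : EuclideanSpace ℝ (Fin dbar) → EuclideanSpace ℝ (Fin d))
    (hfwc : WeaklyConvex ρ₁ f)
    (hflip : LipschitzC C₁ f)
    (hglip : LipschitzC C₂ g)
    (hcase :
      (CoordMonotone f ∧ SmoothL L₂ g) ∨
      (CoordNonDecreasing f ∧ WeaklyConvexVec L₂ g)) :
    WeaklyConvex (Real.sqrt d * L₂ * C₁ + ρ₁ * C₂ ^ 2) (fun x => f (g x)) := by
  rw [weaklyConvex_iff]
  intro x y a b ha hb hab
  have hab0 : 0 ≤ a * b := mul_nonneg ha hb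
  set e := L₂ / 2 * (a * b) * ‖x - y‖ ^ 2 with he
  have he0 : 0 ≤ e := by positivity
  have hmid : f (g (a • x + b • y)) ≤ f (a • g x + b • g y) + C₁ * (Real.sqrt d * e) := by
    rcases hcase with ⟨-, hg⟩ | ⟨hf, hg⟩
    · have h1 := hg.norm_sub_combo_le x y ha hb hab
      have h2 : ‖g (a • x + b • y) - (a • g x + b • g y)‖ ≤ Real.sqrt d * e := by
        rcases Nat.eq_zero_or_pos d with rfl | hd
        · simp [Subsingleton.elim (g (a • x + b • y)) (a • g x + b • g y)]
        · refine h1.trans (le_mul_of_one_le_left he0 ?_)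
          exact Real.one_le_sqrt.2 (by exact_mod_cast hd)
      have h3 := (le_abs_self _).trans (hflip (g (a • x + b • y)) (a • g x + b • g y))
      linarith [mul_le_mul_of_nonneg_left h2 hC₁]
    · refine hf.le_add_of_forall_le_add hflip he0 fun j => ?_
      simpa using weaklyConvex_iff.1 (hg j) x y a b ha hb hab
  have hf := weaklyConvex_iff.1 hfwc (g x) (g y) a b ha hb hab
  have hg2 : ‖g x - g y‖ ^ 2 ≤ C₂ ^ 2 * ‖x - y‖ ^ 2 := by
    rw [← mul_pow]
    exact pow_le_pow_left₀ (norm_nonneg _) (hglip x y) 2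
  have h4 := mul_le_mul_of_nonneg_left hg2 (by positivity : 0 ≤ ρ₁ / 2 * (a * b))
  calc f (g (a • x + b • y))
      ≤ a * f (g x) + b * f (g y) + ρ₁ / 2 * (a * b) * (C₂ ^ 2 * ‖x - y‖ ^ 2)
          + C₁ * (Real.sqrt d * e) := by linarith
    _ = _ := by rw [he]; ring
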